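/- arXiv:2604.15568 — 4 statements merged into one kernel-verified Lean document; each statement's English description precedes it below -/
import Mathlib

section
/- Let L > 0 and let v : ℝ × ℝ² → ℝ² be continuous and satisfy |v(t,x) − v(t,y)| ≤ L |x−y| (1 − log|x−y|) for all t ∈ ℝ and all x, y ∈ ℝ² with 0 < |x−y| ≤ 1. Let a, b ∈ ℝ² with 0 < |a−b| ≤ 1, and let X_a, X_b : [0,T] → ℝ² be differentiable curves with X_a(0) = a, X_b(0) = b, X_a′(t) = v(t, X_a(t)), X_b′(t) = v(t, X_b(t)), and suppose |X_a(t) − X_b(t)| ≤ 1 for all t ∈ [0,T]. Then for every t ∈ [0,T] one has |X_a(t) − X_b(t)| ≤ e · |a−b|^{β(t)} with Hölder exponent β(t) = exp(−Lt). -/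
open Set

/-- Osgood-type comparison: a curve whose speed is at most `L r (1 - log r)` whenever its norm `r`
lies in `(0, 1]`, and which stays in the unit ball, is bounded in norm by the solution
`exp (1 - c exp (-M t))` of `B' = M B (1 - log B)`, for every `M > L`. -/
lemma norm_le_exp_of_logLipschitz_deriv {E : Type*} [NormedAddCommGroup E] [NormedSpace ℝ E]
    {L M T : ℝ} (hLM : L < M) {f f' : ℝ → E}
    (hf : ∀ t ∈ Icc (0 : ℝ) T, HasDerivAt f (f' t) t)
    (hf0 : 0 < ‖f 0‖) (hle : ∀ t ∈ Icc (0 : ℝ) T, ‖f t‖ ≤ 1)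
    (hbound : ∀ t ∈ Icc (0 : ℝ) T, 0 < ‖f t‖ → ‖f' t‖ ≤ L * ‖f t‖ * (1 - Real.log ‖f t‖)) :
    ∀ t ∈ Icc (0 : ℝ) T,
      ‖f t‖ ≤ Real.exp (1 - (1 - Real.log ‖f 0‖) * Real.exp (-M * t)) := by
  intro t ht
  set c := 1 - Real.log ‖f 0‖ with hc_def
  have hc : 0 < c := by
    have := Real.log_nonpos hf0.le (hle 0 ⟨le_rfl, ht.1.trans ht.2⟩)
    linarith
  have hB : ∀ x : ℝ, HasDerivAt (fun s : ℝ => Real.exp (1 - c * Real.exp (-M * s)))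
      (M * Real.exp (1 - c * Real.exp (-M * x)) * (c * Real.exp (-M * x))) x := by
    intro x
    have h := ((((hasDerivAt_id' x).const_mul (-M)).exp.const_mul c).const_sub 1).exp
    convert h using 1
    ring
  refine image_norm_le_of_norm_deriv_right_lt_deriv_boundary
    (fun x hx => (hf x hx).continuousAt.continuousWithinAt)
    (fun x hx => (hf x (Ico_subset_Icc_self hx)).hasDerivWithinAt) ?_ hB ?_ ht
  · simp [hc_def, Real.exp_log hf0]
  · intro x hx heq
    have hpos : 0 < ‖f x‖ := heq ▸ Real.exp_pos _
    refine (hbound x (Ico_subset_Icc_self hx) hpos).trans_lt ?_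
    rw [heq, Real.log_exp, sub_sub_cancel]
    gcongr

/-- Hölder continuity of Lagrangian flow maps of a log-Lipschitz
(Yudovich class) velocity field: if `v` is continuous and satisfies
`|v(t,x) − v(t,y)| ≤ L |x−y| (1 − log|x−y|)` for `0 < |x−y| ≤ 1`, and `X_a`, `X_b`
are flow trajectories starting at `a ≠ b` with `|a−b| ≤ 1` which stay at distance
at most `1` from each other on `[0,T]`, then
`|X_a(t) − X_b(t)| ≤ e · |a−b|^{exp(−Lt)}` on `[0,T]`. -/
theorem logLipschitz_flow_holder
    (L : ℝ) (hL : 0 < L)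
    (v : ℝ → EuclideanSpace ℝ (Fin 2) → EuclideanSpace ℝ (Fin 2))
    (hv_cont : Continuous fun p : ℝ × EuclideanSpace ℝ (Fin 2) => v p.1 p.2)
    (hv_loglip : ∀ (t : ℝ) (x y : EuclideanSpace ℝ (Fin 2)),
      0 < ‖x - y‖ → ‖x - y‖ ≤ 1 →
      ‖v t x - v t y‖ ≤ L * ‖x - y‖ * (1 - Real.log ‖x - y‖))
    (T : ℝ) (a b : EuclideanSpace ℝ (Fin 2))
    (hab_pos : 0 < ‖a - b‖) (hab_le : ‖a - b‖ ≤ 1)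
    (Xa Xb : ℝ → EuclideanSpace ℝ (Fin 2))
    (hXa0 : Xa 0 = a) (hXb0 : Xb 0 = b)
    (hXa : ∀ t ∈ Icc (0 : ℝ) T, HasDerivAt Xa (v t (Xa t)) t)
    (hXb : ∀ t ∈ Icc (0 : ℝ) T, HasDerivAt Xb (v t (Xb t)) t)
    (hclose : ∀ t ∈ Icc (0 : ℝ) T, ‖Xa t - Xb t‖ ≤ 1) :
    ∀ t ∈ Icc (0 : ℝ) T,
      ‖Xa t - Xb t‖ ≤ Real.exp 1 * ‖a - b‖ ^ Real.exp (-L * t) := by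
  intro t ht
  have key : ∀ M, L < M →
      ‖Xa t - Xb t‖ ≤ Real.exp (1 - (1 - Real.log ‖a - b‖) * Real.exp (-M * t)) := by
    intro M hM
    have h := norm_le_exp_of_logLipschitz_deriv (f := fun s => Xa s - Xb s) (T := T) hM
      (fun s hs => (hXa s hs).sub (hXb s hs)) (by simpa [hXa0, hXb0] using hab_pos) hclose
      (fun s hs hpos => hv_loglip s _ _ hpos (hclose s hs)) t ht
    simpa only [hXa0, hXb0] using h
  have hcont : Continuous fun M : ℝ =>
      Real.exp (1 - (1 - Real.log ‖a - b‖) * Real.exp (-M * t)) := by fun_prop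
  have hlim : ‖Xa t - Xb t‖ ≤ Real.exp (1 - (1 - Real.log ‖a - b‖) * Real.exp (-L * t)) :=
    ge_of_tendsto (hcont.continuousWithinAt (s := Ioi L))
      (Filter.mem_of_superset self_mem_nhdsWithin key)
  refine hlim.trans ?_
  rw [Real.rpow_def_of_pos hab_pos, ← Real.exp_add]
  gcongr
  linarith [Real.exp_pos (-L * t)]
end

section
/- There is a universal constant C > 0 such that for every continuously differentiable, compactly supported, not identically zero function ω : ℝ² → ℝ, the Biot–Savart velocity u = 𝕌(ω) is differentiable on ℝ² and its gradient satisfies ‖∇u‖_{L∞} ≤ C ‖ω‖_{L∞} log( 2 + ‖∇ω‖_{L∞} ‖ω‖_{L¹}^{1/2} / ‖ω‖_{L∞}^{3/2} ). -/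
open MeasureTheory ENNReal

noncomputable section

/-- The perpendicular rotation `(z₁, z₂)^⊥ = (−z₂, z₁)` in the plane. -/
def perp (z : EuclideanSpace ℝ (Fin 2)) : EuclideanSpace ℝ (Fin 2) :=
  (WithLp.equiv 2 (Fin 2 → ℝ)).symm ![-(z 1), z 0]

/-- The Biot–Savart velocity `𝕌(ω)(x) = (1/2π) ∫ ((x−y)^⊥/|x−y|²) ω(y) dy`. -/
def biotSavart (ω : EuclideanSpace ℝ (Fin 2) → ℝ) (x : EuclideanSpace ℝ (Fin 2)) :
    EuclideanSpace ℝ (Fin 2) :=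
  (1 / (2 * Real.pi)) • ∫ y, (ω y / ‖x - y‖ ^ 2) • perp (x - y)

open Set Metric
open scoped Convolution

/-- The Euclidean plane. -/
abbrev Plane := EuclideanSpace ℝ (Fin 2)

/-- The rotation `perp` as a continuous linear map. -/
def perpL : Plane →L[ℝ] Plane :=
  LinearMap.toContinuousLinearMap
    { toFun := perp
      map_add' := fun a b => by ext i; fin_cases i <;> simp [perp, add_comm]
      map_smul' := fun c a => by ext i; fin_cases i <;> simp [perp] }

theorem perpL_apply (z : Plane) : perpL z = perp z := rfl

theorem norm_perp (z : Plane) : ‖perp z‖ = ‖z‖ := by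
  simp [perp, EuclideanSpace.norm_eq, Fin.sum_univ_two, add_comm]

theorem continuous_perp : Continuous perp := perpL.continuous

/-- The Biot–Savart kernel regularized at scale `r`; `r = 0` gives the kernel itself. -/
def bsKernel (r : ℝ) (z : Plane) : Plane := (‖z‖ ^ 2 + r ^ 2)⁻¹ • perp z

theorem aestronglyMeasurable_bsKernel (r : ℝ) : AEStronglyMeasurable (bsKernel r) := by
  have h : Measurable fun z : Plane => (‖z‖ ^ 2 + r ^ 2)⁻¹ := by fun_prop
  exact (h.smul continuous_perp.measurable).aestronglyMeasurable

theorem contDiff_bsKernel {r : ℝ} (hr : 0 < r) : ContDiff ℝ 1 (bsKernel r) := by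
  have h : ContDiff ℝ 1 fun z : Plane => (‖z‖ ^ 2 + r ^ 2)⁻¹ :=
    ((contDiff_norm_sq ℝ).add contDiff_const).inv fun z => by positivity
  exact h.smul perpL.contDiff

theorem hasFDerivAt_bsKernel {r : ℝ} (hr : 0 < r) (z : Plane) :
    HasFDerivAt (bsKernel r)
      ((‖z‖ ^ 2 + r ^ 2)⁻¹ • perpL +
        ((-((‖z‖ ^ 2 + r ^ 2) ^ 2)⁻¹) • (2 • innerSL ℝ z)).smulRight (perp z)) z := by
  have h1 : HasFDerivAt (fun z : Plane => ‖z‖ ^ 2 + r ^ 2) (2 • innerSL ℝ z) z :=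
    (hasStrictFDerivAt_norm_sq z).hasFDerivAt.add_const _
  have h2 : HasFDerivAt (fun z : Plane => (‖z‖ ^ 2 + r ^ 2)⁻¹) _ z :=
    (hasDerivAt_inv (by positivity)).comp_hasFDerivAt z h1
  exact h2.smul perpL.hasFDerivAt

theorem norm_fderiv_bsKernel_le {r : ℝ} (hr : 0 < r) (z v : Plane) :
    ‖fderiv ℝ (bsKernel r) z v‖ ≤ 3 * (‖z‖ ^ 2 + r ^ 2)⁻¹ * ‖v‖ := by
  rw [(hasFDerivAt_bsKernel hr z).fderiv]
  have hp : 0 < ‖z‖ ^ 2 + r ^ 2 := by positivity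
  set s := ‖z‖ ^ 2 + r ^ 2 with hs
  simp only [add_apply, smul_apply, perpL_apply,
    ContinuousLinearMap.smulRight_apply, innerSL_apply_apply]
  refine (norm_add_le _ _).trans ?_
  rw [norm_smul, norm_smul, norm_perp, norm_perp, norm_inv, Real.norm_of_nonneg hp.le,
    smul_eq_mul, norm_mul, norm_neg, norm_inv, norm_pow, Real.norm_of_nonneg hp.le]
  have h1 : ‖(2 : ℕ) • inner ℝ z v‖ ≤ 2 * (‖z‖ * ‖v‖) := by
    rw [nsmul_eq_mul, norm_mul]
    simpa using norm_inner_le_norm (𝕜 := ℝ) z v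
  have h2 : ‖z‖ ^ 2 * (s ^ 2)⁻¹ ≤ s⁻¹ := by
    rw [← div_eq_mul_inv, div_le_iff₀ (by positivity)]
    field_simp
    nlinarith [sq_nonneg r]
  calc s⁻¹ * ‖v‖ + (s ^ 2)⁻¹ * ‖(2 : ℕ) • inner ℝ z v‖ * ‖z‖
      ≤ s⁻¹ * ‖v‖ + (s ^ 2)⁻¹ * (2 * (‖z‖ * ‖v‖)) * ‖z‖ := by gcongr
    _ = s⁻¹ * ‖v‖ + 2 * (‖z‖ ^ 2 * (s ^ 2)⁻¹) * ‖v‖ := by ring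
    _ ≤ s⁻¹ * ‖v‖ + 2 * s⁻¹ * ‖v‖ := by gcongr
    _ = 3 * s⁻¹ * ‖v‖ := by ring

theorem norm_bsKernel_sub {r : ℝ} (hr : 0 < r) (z : Plane) :
    ‖bsKernel 0 z - bsKernel r z‖ = r ^ 2 / (‖z‖ * (‖z‖ ^ 2 + r ^ 2)) := by
  rw [bsKernel, bsKernel, ← sub_smul, norm_smul, norm_perp]
  rcases eq_or_ne z 0 with rfl | hz
  · simp
  have hz : 0 < ‖z‖ := norm_pos_iff.2 hz
  have h : (‖z‖ ^ 2 + 0 ^ 2)⁻¹ - (‖z‖ ^ 2 + r ^ 2)⁻¹ = r ^ 2 / (‖z‖ ^ 2 * (‖z‖ ^ 2 + r ^ 2)) := by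
    field_simp
    ring
  rw [h, Real.norm_of_nonneg (by positivity)]
  field_simp

theorem mul_div_eq_inv_one_add_sq {r y : ℝ} (hr : 0 < r) (hy : 0 < y) :
    y * (r ^ 2 / (y * (y ^ 2 + r ^ 2))) = (1 + (r⁻¹ * y) ^ 2)⁻¹ := by
  field_simp
  ring

theorem integrable_radial {r : ℝ} (hr : 0 < r) :
    Integrable fun z : Plane => r ^ 2 / (‖z‖ * (‖z‖ ^ 2 + r ^ 2)) := by
  refine (integrable_fun_norm_addHaar (E := Plane) volume
    (f := fun y => r ^ 2 / (y * (y ^ 2 + r ^ 2)))).2 ?_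
  have h :=
    (integrable_inv_one_add_sq.comp_mul_left' (inv_ne_zero hr.ne')).integrableOn (s := Ioi 0)
  refine h.congr_fun (fun y hy => ?_) measurableSet_Ioi
  simpa using (mul_div_eq_inv_one_add_sq hr hy).symm

theorem integral_radial {r : ℝ} (hr : 0 < r) :
    ∫ z : Plane, r ^ 2 / (‖z‖ * (‖z‖ ^ 2 + r ^ 2)) =
      (volume : Measure Plane).real (ball 0 1) * Real.pi * r := by
  rw [integral_fun_norm_addHaar (E := Plane) volume (fun y => r ^ 2 / (y * (y ^ 2 + r ^ 2)))]
  have h : ∫ y in Ioi (0 : ℝ), y ^ (Module.finrank ℝ Plane - 1) • (r ^ 2 / (y * (y ^ 2 + r ^ 2))) =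
      ∫ y in Ioi (0 : ℝ), (1 + (r⁻¹ * y) ^ 2)⁻¹ :=
    setIntegral_congr_fun measurableSet_Ioi fun y hy => by
      simpa using mul_div_eq_inv_one_add_sq hr hy
  rw [h, integral_comp_mul_left_Ioi (fun y : ℝ => (1 + y ^ 2)⁻¹) 0 (inv_pos.2 hr)]
  simp
  ring

theorem integral_ball_inv {r R : ℝ} (hr : 0 < r) (hR : 0 < R) :
    ∫ z in ball (0 : Plane) R, (‖z‖ ^ 2 + r ^ 2)⁻¹ =
      (volume : Measure Plane).real (ball 0 1) * Real.log (1 + (R / r) ^ 2) := by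
  have h1 : ∫ z in ball (0 : Plane) R, (‖z‖ ^ 2 + r ^ 2)⁻¹ =
      ∫ z : Plane, (Iio R).indicator (fun y => (y ^ 2 + r ^ 2)⁻¹) ‖z‖ := by
    rw [← integral_indicator measurableSet_ball]
    congr 1 with z
    simp [indicator]
  have h2 : ∫ y in Ioi (0 : ℝ), y ^ (Module.finrank ℝ Plane - 1) •
      (Iio R).indicator (fun y => (y ^ 2 + r ^ 2)⁻¹) y = ∫ y in 0..R, y * (y ^ 2 + r ^ 2)⁻¹ := by
    rw [intervalIntegral.integral_of_le hR.le, integral_Ioc_eq_integral_Ioo,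
      ← Ioi_inter_Iio, ← setIntegral_indicator measurableSet_Iio]
    congr 1 with y
    by_cases hy : y < R <;> simp [hy]
  have h3 : ∫ y in 0..R, y * (y ^ 2 + r ^ 2)⁻¹ = Real.log (1 + (R / r) ^ 2) / 2 := by
    have hd : ∀ y ∈ uIcc 0 R, HasDerivAt (fun y => Real.log (y ^ 2 + r ^ 2) / 2)
        (y * (y ^ 2 + r ^ 2)⁻¹) y := fun y _ => by
      have := (((hasDerivAt_pow 2 y).add_const (r ^ 2)).log (by positivity)).div_const 2
      refine this.congr_deriv ?_
      norm_num
      field_simp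
    rw [intervalIntegral.integral_eq_sub_of_hasDerivAt hd, ← sub_div,
      ← Real.log_div (by positivity) (by positivity)]
    · congr 2
      field_simp
      ring
    · refine Continuous.intervalIntegrable ?_ _ _
      exact continuous_id.mul
        (Continuous.inv₀ (by fun_prop) fun y => by positivity)
  rw [h1, integral_fun_norm_addHaar (E := Plane) volume, h2, h3]
  simp
  ring

theorem integrable_inv_ball {r : ℝ} (hr : 0 < r) (R : ℝ) :
    IntegrableOn (fun z : Plane => (‖z‖ ^ 2 + r ^ 2)⁻¹) (ball 0 R) := by
  have h : Continuous fun z : Plane => (‖z‖ ^ 2 + r ^ 2)⁻¹ :=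
    Continuous.inv₀ (by fun_prop) fun y => by positivity
  exact (h.continuousOn.integrableOn_compact (isCompact_closedBall 0 R)).mono_set
    ball_subset_closedBall

theorem locallyIntegrable_bsKernel : LocallyIntegrable (bsKernel 0) := by
  have h1 : Integrable fun z => bsKernel 0 z - bsKernel 1 z :=
    (integrable_radial one_pos).mono'
      ((aestronglyMeasurable_bsKernel 0).sub (aestronglyMeasurable_bsKernel 1))
      (.of_forall fun z => (norm_bsKernel_sub one_pos z).le)
  have h2 := h1.locallyIntegrable.add (contDiff_bsKernel one_pos).continuous.locallyIntegrable
  exact h2.congr (.of_forall fun z => by simp)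

theorem biotSavart_eq_convolution (ω : Plane → ℝ) :
    biotSavart ω = fun x => (1 / (2 * Real.pi)) •
      (bsKernel 0 ⋆[(ContinuousLinearMap.lsmul ℝ ℝ : ℝ →L[ℝ] Plane →L[ℝ] Plane).flip, volume] ω) x := by
  ext1 x
  rw [biotSavart, convolution_def, ← integral_sub_left_eq_self _ volume x]
  congr 2 with y
  simp [bsKernel, smul_smul, div_eq_mul_inv, mul_comm]

variable {ω : Plane → ℝ}

theorem hasFDerivAt_biotSavart (hω : ContDiff ℝ 1 ω) (hc : HasCompactSupport ω) (x : Plane) :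
    HasFDerivAt (biotSavart ω) ((1 / (2 * Real.pi)) •
      (bsKernel 0 ⋆[((ContinuousLinearMap.lsmul ℝ ℝ :
        ℝ →L[ℝ] Plane →L[ℝ] Plane).flip).precompR Plane, volume] fderiv ℝ ω) x) x := by
  rw [biotSavart_eq_convolution]
  exact (hc.hasFDerivAt_convolution_right
    (ContinuousLinearMap.lsmul ℝ ℝ : ℝ →L[ℝ] Plane →L[ℝ] Plane).flip
    locallyIntegrable_bsKernel hω x).const_smul (1 / (2 * Real.pi))

theorem fderiv_biotSavart_apply (hω : ContDiff ℝ 1 ω) (hc : HasCompactSupport ω) (x v : Plane) :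
    fderiv ℝ (biotSavart ω) x v =
      (1 / (2 * Real.pi)) • ∫ t, fderiv ℝ ω (x - t) v • bsKernel 0 t := by
  rw [(hasFDerivAt_biotSavart hω hc x).fderiv, smul_apply,
    convolution_precompR_apply _ locallyIntegrable_bsKernel (hc.fderiv ℝ)
      (hω.continuous_fderiv one_ne_zero), convolution_def]
  rfl

theorem ae_comp_sub_left {p : Plane → Prop} (h : ∀ᵐ y, p y) (x : Plane) : ∀ᵐ t, p (x - t) :=
  (Measure.measurePreserving_sub_left volume x).quasiMeasurePreserving.ae h

theorem hasCompactSupport_comp_sub_left {F : Type*} [Zero F] {f : Plane → F}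
    (hf : HasCompactSupport f) (x : Plane) : HasCompactSupport fun t => f (x - t) :=
  hf.comp_homeomorph (Homeomorph.subLeft x)

theorem integral_fderiv_smul_bsKernel (hω : ContDiff ℝ 1 ω) (hc : HasCompactSupport ω)
    {r : ℝ} (hr : 0 < r) (x v : Plane) :
    ∫ t, fderiv ℝ ω (x - t) v • bsKernel r t =
      ∫ t, ω (x - t) • fderiv ℝ (bsKernel r) t v := by
  have hK := contDiff_bsKernel hr
  have hg : ContDiff ℝ 1 fun t => ω (x - t) := hω.comp (contDiff_const.sub contDiff_id)
  have hgc := hasCompactSupport_comp_sub_left hc x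
  have hd : ∀ t, fderiv ℝ (fun t => ω (x - t)) t v = -fderiv ℝ ω (x - t) v := fun t => by
    have h : HasFDerivAt (fun t => x - t) (-ContinuousLinearMap.id ℝ Plane) t :=
      (hasFDerivAt_id t).const_sub x
    have h' : HasFDerivAt (fun t => ω (x - t)) _ t :=
      (hω.differentiable one_ne_zero (x - t)).hasFDerivAt.comp t h
    rw [h'.fderiv]
    simp
  rw [integral_smul_fderiv_eq_neg_fderiv_smul_of_integrable]
  · simp [hd, integral_neg]
  · exact (((hg.continuous_fderiv one_ne_zero).clm_apply continuous_const).smul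
      hK.continuous).integrable_of_hasCompactSupport (hgc.fderiv_apply ℝ v).smul_right
  · exact (hg.continuous.smul ((hK.continuous_fderiv one_ne_zero).clm_apply
      continuous_const)).integrable_of_hasCompactSupport hgc.smul_right
  · exact (hg.continuous.smul hK.continuous).integrable_of_hasCompactSupport hgc.smul_right
  · exact fun t _ => (hg.differentiable one_ne_zero) t
  · exact fun t _ => (hK.differentiable one_ne_zero) t

theorem norm_integral_inner_le {G r : ℝ} (hr : 0 < r) (hG : ∀ᵐ y, ‖fderiv ℝ ω y‖ ≤ G)
    (x v : Plane) :
    ‖∫ t, fderiv ℝ ω (x - t) v • (bsKernel 0 t - bsKernel r t)‖ ≤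
      G * ‖v‖ * ((volume : Measure Plane).real (ball 0 1) * Real.pi * r) := by
  rw [← integral_radial hr, ← integral_const_mul]
  refine norm_integral_le_of_norm_le ((integrable_radial hr).const_mul _) ?_
  filter_upwards [ae_comp_sub_left hG x] with t ht
  rw [norm_smul, norm_bsKernel_sub hr]
  gcongr
  exact (ContinuousLinearMap.le_opNorm _ _).trans (by gcongr)

theorem norm_integral_outer_le (hω : ContDiff ℝ 1 ω) (hc : HasCompactSupport ω)
    {M r R : ℝ} (hr : 0 < r) (hR : 0 < R) (hM : ∀ᵐ y, ‖ω y‖ ≤ M) (x v : Plane) :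
    ‖∫ t, ω (x - t) • fderiv ℝ (bsKernel r) t v‖ ≤
      3 * ‖v‖ * (M * ((volume : Measure Plane).real (ball 0 1) * Real.log (1 + (R / r) ^ 2)) +
        (R ^ 2)⁻¹ * ∫ y, ‖ω y‖) := by
  have hi : Integrable fun t => ‖ω (x - t)‖ :=
    ((hω.continuous.integrable_of_hasCompactSupport hc).comp_sub_left x).norm
  have hb := (integrable_indicator_iff measurableSet_ball).2 (integrable_inv_ball hr R)
  rw [← integral_ball_inv hr hR, ← integral_sub_left_eq_self (fun y => ‖ω y‖) volume x,
    ← integral_indicator measurableSet_ball, ← integral_const_mul, ← integral_const_mul,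
    ← integral_add (hb.const_mul _) (hi.const_mul _), ← integral_const_mul]
  refine norm_integral_le_of_norm_le (((hb.const_mul _).add (hi.const_mul _)).const_mul _) ?_
  filter_upwards [ae_comp_sub_left hM x] with t ht
  have hM0 : 0 ≤ M := (norm_nonneg _).trans ht
  rw [norm_smul]
  calc ‖ω (x - t)‖ * ‖fderiv ℝ (bsKernel r) t v‖
      ≤ ‖ω (x - t)‖ * (3 * (‖t‖ ^ 2 + r ^ 2)⁻¹ * ‖v‖) := by
        gcongr
        exact norm_fderiv_bsKernel_le hr t v
    _ = 3 * ‖v‖ * (‖ω (x - t)‖ * (‖t‖ ^ 2 + r ^ 2)⁻¹) := by ring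
    _ ≤ _ := by
        gcongr
        by_cases h : t ∈ ball (0 : Plane) R
        · rw [indicator_of_mem h]
          exact (mul_le_mul_of_nonneg_right ht (by positivity)).trans
            (le_add_of_nonneg_right (by positivity))
        · rw [indicator_of_notMem h, mul_zero, zero_add, mul_comm]
          have h : R ≤ ‖t‖ := by simpa using h
          gcongr
          nlinarith [sq_nonneg r]

theorem norm_fderiv_biotSavart_apply_le (hω : ContDiff ℝ 1 ω) (hc : HasCompactSupport ω)
    {M G r R : ℝ} (hr : 0 < r) (hR : 0 < R) (hM : ∀ᵐ y, ‖ω y‖ ≤ M)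
    (hG : ∀ᵐ y, ‖fderiv ℝ ω y‖ ≤ G) (x v : Plane) :
    ‖fderiv ℝ (biotSavart ω) x v‖ ≤
      G * ‖v‖ * ((volume : Measure Plane).real (ball 0 1) * Real.pi * r) +
      3 * ‖v‖ * (M * ((volume : Measure Plane).real (ball 0 1) * Real.log (1 + (R / r) ^ 2)) +
        (R ^ 2)⁻¹ * ∫ y, ‖ω y‖) := by
  have hcd := hasCompactSupport_comp_sub_left (hc.fderiv_apply ℝ v) x
  have hcont : Continuous fun t => fderiv ℝ ω (x - t) v :=
    ((hω.continuous_fderiv one_ne_zero).comp (continuous_const.sub continuous_id)).clm_apply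
      continuous_const
  have h0 : Integrable fun t => fderiv ℝ ω (x - t) v • bsKernel 0 t :=
    locallyIntegrable_bsKernel.integrable_smul_left_of_hasCompactSupport hcont hcd
  have h1 : Integrable fun t => fderiv ℝ ω (x - t) v • bsKernel r t :=
    (hcont.smul (contDiff_bsKernel hr).continuous).integrable_of_hasCompactSupport hcd.smul_right
  have hsplit : ∫ t, fderiv ℝ ω (x - t) v • bsKernel 0 t =
      (∫ t, fderiv ℝ ω (x - t) v • (bsKernel 0 t - bsKernel r t)) +
        ∫ t, ω (x - t) • fderiv ℝ (bsKernel r) t v := by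
    rw [← integral_fderiv_smul_bsKernel hω hc hr]
    simp_rw [smul_sub]
    rw [integral_sub h0 h1, sub_add_cancel]
  rw [fderiv_biotSavart_apply hω hc, norm_smul, hsplit]
  have hpi : ‖1 / (2 * Real.pi)‖ ≤ 1 := by
    rw [Real.norm_of_nonneg (by positivity), div_le_one (by positivity)]
    linarith [Real.pi_gt_three]
  refine (mul_le_of_le_one_left (norm_nonneg _) hpi).trans ((norm_add_le _ _).trans ?_)
  exact add_le_add (norm_integral_inner_le hr hG x v) (norm_integral_outer_le hω hc hr hR hM x v)

theorem ae_norm_le_toReal_eLpNorm_top {F : Type*} [NormedAddCommGroup F] {f : Plane → F}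
    (hf : Continuous f) (hc : HasCompactSupport f) :
    ∀ᵐ y, ‖f y‖ ≤ (eLpNorm f ⊤ volume).toReal := by
  have hfin := (hf.memLp_of_hasCompactSupport (μ := volume) (p := ⊤) hc).eLpNorm_ne_top
  filter_upwards [ae_le_eLpNormEssSup (f := f) (μ := volume)] with y hy
  rw [← eLpNorm_exponent_top] at hy
  simpa using ENNReal.toReal_mono hfin hy

theorem toReal_eLpNorm_pos (hf : Continuous ω) (hc : HasCompactSupport ω) (h0 : ω ≠ 0)
    {p : ℝ≥0∞} (hp : p ≠ 0) : 0 < (eLpNorm ω p volume).toReal := by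
  refine ENNReal.toReal_pos (fun h => h0 ?_)
    (hf.memLp_of_hasCompactSupport (μ := volume) (p := p) hc).eLpNorm_ne_top
  rw [eLpNorm_eq_zero_iff hf.aestronglyMeasurable hp] at h
  exact (hf.ae_eq_iff_eq volume continuous_const).1 h

theorem log_one_add_sq_le {q : ℝ} (hq : 0 ≤ q) :
    Real.log (1 + (1 + q) ^ 2) ≤ 2 * Real.log (2 + q) := by
  rw [← Real.log_rpow (by positivity), Real.rpow_two]
  exact Real.log_le_log (by positivity) (by nlinarith)

theorem one_le_two_mul_log_two_add {q : ℝ} (hq : 0 ≤ q) : 1 ≤ 2 * Real.log (2 + q) := by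
  have := Real.log_le_log two_pos (le_add_of_nonneg_right hq)
  linarith [Real.log_two_gt_d9]

/-- There is a universal constant `C > 0` such that for every
`C¹`, compactly supported, not identically zero `ω : ℝ² → ℝ`, the Biot–Savart
velocity `u = 𝕌(ω)` is differentiable and
`‖∇u‖_{L∞} ≤ C ‖ω‖_{L∞} log(2 + ‖∇ω‖_{L∞} ‖ω‖_{L¹}^{1/2} / ‖ω‖_{L∞}^{3/2})`. -/
theorem biotSavart_gradient_log_bound :
    ∃ C : ℝ, 0 < C ∧
      ∀ ω : EuclideanSpace ℝ (Fin 2) → ℝ,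
        ContDiff ℝ 1 ω → HasCompactSupport ω → ω ≠ 0 →
        Differentiable ℝ (biotSavart ω) ∧
        ∀ x : EuclideanSpace ℝ (Fin 2),
          ‖fderiv ℝ (biotSavart ω) x‖ ≤
            C * (eLpNorm ω ⊤ volume).toReal *
              Real.log (2 +
                (eLpNorm (fun y => ‖fderiv ℝ ω y‖) ⊤ volume).toReal *
                  (eLpNorm ω 1 volume).toReal ^ ((1 : ℝ) / 2) /
                    (eLpNorm ω ⊤ volume).toReal ^ ((3 : ℝ) / 2)) := by
  set V := (volume : Measure Plane).real (ball 0 1) with hV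
  have hV0 : 0 ≤ V := measureReal_nonneg
  refine ⟨2 * V * Real.pi + 6 * V + 6, by positivity, fun ω hω hc h0 =>
    ⟨fun x => (hasFDerivAt_biotSavart hω hc x).differentiableAt, fun x => ?_⟩⟩
  have hM := ae_norm_le_toReal_eLpNorm_top hω.continuous hc
  have hG := ae_norm_le_toReal_eLpNorm_top (hω.continuous_fderiv one_ne_zero) (hc.fderiv ℝ)
  have hM0 := toReal_eLpNorm_pos hω.continuous hc h0 top_ne_zero
  have hL0 := toReal_eLpNorm_pos hω.continuous hc h0 one_ne_zero
  have hL : ∫ y, ‖ω y‖ = (eLpNorm ω 1 volume).toReal := by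
    rw [eLpNorm_one_eq_lintegral_enorm,
      integral_norm_eq_lintegral_enorm hω.continuous.aestronglyMeasurable]
  rw [eLpNorm_norm]
  set M := (eLpNorm ω ⊤ volume).toReal
  set G := (eLpNorm (fderiv ℝ ω) ⊤ volume).toReal
  set L := (eLpNorm ω 1 volume).toReal
  have hG0 : 0 ≤ G := ENNReal.toReal_nonneg
  set q := G * L ^ ((1 : ℝ) / 2) / M ^ ((3 : ℝ) / 2) with hq
  have hq0 : 0 ≤ q := by positivity
  set R := √(L / M) with hRdef
  have hR : 0 < R := by positivity
  have hR2 : R ^ 2 = L / M := Real.sq_sqrt (by positivity)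
  have hqR : q = R * G / M := by
    have h32 : M ^ ((3 : ℝ) / 2) = M * √M := by
      rw [show (3 : ℝ) / 2 = 1 + 1 / 2 by norm_num, Real.rpow_add hM0, Real.rpow_one,
        Real.sqrt_eq_rpow]
    rw [hq, h32, ← Real.sqrt_eq_rpow, hRdef, Real.sqrt_div hL0.le]
    field_simp
  set r := M / (G + M / R) with hrdef
  have hr : 0 < r := by positivity
  have hRr : R / r = 1 + q := by
    rw [hrdef, hqR]
    field_simp
    ring
  have hGr : G * r ≤ M := by
    rw [hrdef, mul_div_assoc', div_le_iff₀ (by positivity)]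
    have : 0 ≤ M * (M / R) := by positivity
    linarith
  have hlog := log_one_add_sq_le hq0
  have hone := one_le_two_mul_log_two_add hq0
  set l := Real.log (2 + q)
  have hl : 0 ≤ l := by linarith
  refine ContinuousLinearMap.opNorm_le_bound _ (by positivity) fun v => ?_
  refine (norm_fderiv_biotSavart_apply_le hω hc hr hR hM hG x v).trans ?_
  have hLR : (R ^ 2)⁻¹ * L = M := by
    rw [hR2]
    field_simp
  rw [hL, hRr, hLR, ← hV]
  calc G * ‖v‖ * (V * Real.pi * r) + 3 * ‖v‖ * (M * (V * Real.log (1 + (1 + q) ^ 2)) + M)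
      = (V * Real.pi * (G * r) + 3 * (M * (V * Real.log (1 + (1 + q) ^ 2)) + M * 1)) * ‖v‖ := by
        ring
    _ ≤ (V * Real.pi * (M * (2 * l)) + 3 * (M * (V * (2 * l)) + M * (2 * l))) * ‖v‖ := by
        have : G * r ≤ M * (2 * l) := hGr.trans (le_mul_of_one_le_right hM0.le hone)
        gcongr
    _ = (2 * V * Real.pi + 6 * V + 6) * M * l * ‖v‖ := by ring

end
end

section
/- Let x₀ < 0 < y₀ and set C₀ = (1/(2π)) x₀³ / ( y₀ (x₀² + y₀²) ), which is negative. Suppose (x, y) : [0,T) → ℝ² is differentiable, satisfies x(0) = x₀, y(0) = y₀, remains in the quadrant {x < 0, y > 0} on [0,T), and solves dx/dt = (1/(4π)) x² / ( y (x² + y²) ), dy/dt = (1/(4π)) x / (x² + y²). Then x(t)² = x₀² + C₀ t for all t ∈ [0,T); consequently T ≤ T* := −x₀²/C₀, and if T = T* then (x(t), y(t)) → (0,0) as t → T*⁻, i.e. the vortices merge at the origin in the finite time T*. -/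
open Set Real Filter

/-- A function with zero derivative on `[0, T)` is constant there. -/
theorem eq_apply_zero_of_hasDerivAt_zero {f : ℝ → ℝ} {T : ℝ}
    (hf : ∀ t ∈ Ico (0 : ℝ) T, HasDerivAt f 0 t) : ∀ t ∈ Ico (0 : ℝ) T, f t = f 0 := by
  intro t ht
  refine constant_of_has_deriv_right_zero (a := 0) (b := t) ?_ ?_ t ⟨ht.1, le_rfl⟩
  · exact fun s hs => (hf s ⟨hs.1, hs.2.trans_lt ht.2⟩).continuousAt.continuousWithinAt
  · exact fun s hs => (hf s ⟨hs.1, hs.2.trans ht.2⟩).hasDerivWithinAt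

/-- For the point-vortex system
`dx/dt = (1/4π) x²/(y(x²+y²))`, `dy/dt = (1/4π) x/(x²+y²)` with initial data
`x₀ < 0 < y₀` and `C₀ = (1/2π) x₀³/(y₀(x₀²+y₀²)) < 0`, as long as the solution
stays in the quadrant `{x < 0, y > 0}` one has `x(t)² = x₀² + C₀ t`; consequently
`T ≤ T* = −x₀²/C₀`, and if `T = T*` then `(x(t), y(t)) → (0,0)` as `t → T*⁻`:
the vortices merge at the origin in the finite time `T*`. -/
theorem point_vortex_finite_time_merger
    (x₀ y₀ : ℝ) (hx₀ : x₀ < 0) (hy₀ : 0 < y₀)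
    (C₀ : ℝ) (hC₀ : C₀ = (1 / (2 * π)) * x₀ ^ 3 / (y₀ * (x₀ ^ 2 + y₀ ^ 2)))
    (T : ℝ) (hT : 0 < T)
    (x y : ℝ → ℝ)
    (hx0 : x 0 = x₀) (hy0 : y 0 = y₀)
    (hquad : ∀ t ∈ Ico (0:ℝ) T, x t < 0 ∧ 0 < y t)
    (hx : ∀ t ∈ Ico (0:ℝ) T,
      HasDerivAt x ((1 / (4 * π)) * (x t) ^ 2 / (y t * ((x t) ^ 2 + (y t) ^ 2))) t)
    (hy : ∀ t ∈ Ico (0:ℝ) T,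
      HasDerivAt y ((1 / (4 * π)) * x t / ((x t) ^ 2 + (y t) ^ 2)) t) :
    (∀ t ∈ Ico (0:ℝ) T, (x t) ^ 2 = x₀ ^ 2 + C₀ * t) ∧
    T ≤ -x₀ ^ 2 / C₀ ∧
    (T = -x₀ ^ 2 / C₀ →
      Tendsto (fun t => (x t, y t)) (nhdsWithin T (Iio T)) (nhds (0, 0))) := by
  have hπ : π ≠ 0 := pi_ne_zero
  have hx₀' : x₀ ≠ 0 := hx₀.ne
  have hC₀neg : C₀ < 0 := by
    rw [hC₀]
    have hcube : x₀ ^ 3 < 0 := Odd.pow_neg (by decide) hx₀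
    exact div_neg_of_neg_of_pos (mul_neg_of_pos_of_neg (by positivity) hcube) (by positivity)
  have hratio : ∀ t ∈ Ico (0 : ℝ) T, x t / y t = x₀ / y₀ := by
    have key := eq_apply_zero_of_hasDerivAt_zero (f := fun t => x t / y t) (T := T) (by
      intro t ht
      have hyt := (hquad t ht).2
      have hr : x t ^ 2 + y t ^ 2 ≠ 0 := by positivity
      refine ((hx t ht).div (hy t ht) hyt.ne').congr_deriv ?_
      field_simp
      ring)
    intro t ht
    simpa only [hx0, hy0] using key t ht
  have hy_eq : ∀ t ∈ Ico (0 : ℝ) T, y t = y₀ / x₀ * x t := by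
    intro t ht
    have hyt := (hquad t ht).2.ne'
    have h := hratio t ht
    field_simp at h ⊢
    linarith
  have hsq : ∀ t ∈ Ico (0 : ℝ) T, x t ^ 2 = x₀ ^ 2 + C₀ * t := by
    have key := eq_apply_zero_of_hasDerivAt_zero (f := fun t => x t ^ 2 - C₀ * t) (T := T) (by
      intro t ht
      have hxt := (hquad t ht).1.ne
      have hr : x₀ ^ 2 + y₀ ^ 2 ≠ 0 := by positivity
      refine (((hx t ht).pow 2).sub ((hasDerivAt_id t).const_mul C₀)).congr_deriv ?_
      have hsum : x t ^ 2 + (y₀ / x₀ * x t) ^ 2 = (x₀ ^ 2 + y₀ ^ 2) * (x t / x₀) ^ 2 := by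
        field_simp
      rw [hy_eq t ht, hsum, hC₀]
      field_simp
      norm_num
      right
      ring)
    intro t ht
    have h := key t ht
    simp only [hx0, mul_zero, sub_zero] at h
    linarith
  refine ⟨hsq, ?_, ?_⟩
  · by_contra! hlt
    have hmem : -x₀ ^ 2 / C₀ ∈ Ico (0 : ℝ) T :=
      ⟨div_nonneg_of_nonpos (neg_nonpos.2 (sq_nonneg x₀)) hC₀neg.le, hlt⟩
    have h := hsq _ hmem
    rw [mul_div_cancel₀ _ hC₀neg.ne, add_neg_cancel] at h
    exact (hquad _ hmem).1.ne (pow_eq_zero_iff two_ne_zero |>.1 h)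
  · intro hTeq
    have hev : ∀ᶠ t in nhdsWithin T (Iio T), t ∈ Ico (0 : ℝ) T := Ico_mem_nhdsLT hT
    have hlim : Tendsto (fun t => -√(x₀ ^ 2 + C₀ * t)) (nhdsWithin T (Iio T)) (nhds 0) := by
      have hc : Continuous fun t => -√(x₀ ^ 2 + C₀ * t) := by fun_prop
      have hzero : -√(x₀ ^ 2 + C₀ * T) = 0 := by
        rw [hTeq, mul_div_cancel₀ _ hC₀neg.ne, add_neg_cancel, sqrt_zero, neg_zero]
      simpa only [hzero] using (hc.tendsto T).mono_left nhdsWithin_le_nhds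
    have hxlim : Tendsto x (nhdsWithin T (Iio T)) (nhds 0) := by
      refine hlim.congr' ?_
      filter_upwards [hev] with t ht
      rw [← hsq t ht, sqrt_sq_eq_abs, abs_of_neg (hquad t ht).1, neg_neg]
    have hylim : Tendsto y (nhdsWithin T (Iio T)) (nhds 0) := by
      have h := hxlim.const_mul (y₀ / x₀)
      rw [mul_zero] at h
      refine h.congr' ?_
      filter_upwards [hev] with t ht
      exact (hy_eq t ht).symm
    exact hxlim.prodMk_nhds hylim
end

section
/- Let σ₊, σ₋ : ℝ × ℝ² → ℝ be smooth, with σ±(t,·) compactly supported and integrable for each t, and suppose they solve the unscreened right-handed system pointwise: ∂ₜσ₊ − 𝕌(σ₋)·∇σ₊ = 0 and ∂ₜσ₋ + 𝕌(σ₊)·∇σ₋ = 0. Define η₊(t, x₁, x₂) := σ₋(t, x₁, −x₂) and η₋(t, x₁, x₂) := σ₊(t, x₁, −x₂). Then the pair (η₊, η₋) also solves the same system: ∂ₜη₊ − 𝕌(η₋)·∇η₊ = 0 and ∂ₜη₋ + 𝕌(η₊)·∇η₋ = 0. In particular, the mirror symmetry σ₊(t, x₁, x₂) = σ₋(t, x₁,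 −x₂) is preserved by the evolution for unique solutions. -/
open MeasureTheory ENNReal

noncomputable section

/-- Reflection across the `x₁`-axis: `(x₁, x₂) ↦ (x₁, −x₂)`. -/
def reflect₂ (x : EuclideanSpace ℝ (Fin 2)) : EuclideanSpace ℝ (Fin 2) :=
  (WithLp.equiv 2 (Fin 2 → ℝ)).symm ![x 0, -(x 1)]

/-- The pair `(σ₊, σ₋)` solves the unscreened right-handed system
`∂ₜσ₊ − 𝕌(σ₋)·∇σ₊ = 0`, `∂ₜσ₋ + 𝕌(σ₊)·∇σ₋ = 0` pointwise. -/
def SolvesUnscreenedRH (σp σm : ℝ → EuclideanSpace ℝ (Fin 2) → ℝ) : Prop :=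
  ∀ (t : ℝ) (x : EuclideanSpace ℝ (Fin 2)),
    deriv (fun s => σp s x) t - fderiv ℝ (σp t) x (biotSavart (σm t) x) = 0 ∧
    deriv (fun s => σm s x) t + fderiv ℝ (σm t) x (biotSavart (σp t) x) = 0

/-- The reflection across the `x₁`-axis as a linear isometric equivalence. -/
def reflectEquiv : EuclideanSpace ℝ (Fin 2) ≃ₗᵢ[ℝ] EuclideanSpace ℝ (Fin 2) where
  toFun := reflect₂
  invFun := reflect₂
  map_add' x y := by ext i; fin_cases i <;> simp [reflect₂, add_comm]
  map_smul' c x := by ext i; fin_cases i <;> simp [reflect₂]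
  left_inv x := by ext i; fin_cases i <;> simp [reflect₂]
  right_inv x := by ext i; fin_cases i <;> simp [reflect₂]
  norm_map' x := by simp [reflect₂, EuclideanSpace.norm_eq]

theorem reflectEquiv_apply (x : EuclideanSpace ℝ (Fin 2)) : reflectEquiv x = reflect₂ x := rfl

theorem reflectEquiv_reflectEquiv (x : EuclideanSpace ℝ (Fin 2)) :
    reflectEquiv (reflectEquiv x) = x :=
  reflectEquiv.left_inv x

theorem perp_reflectEquiv (z : EuclideanSpace ℝ (Fin 2)) :
    perp (reflectEquiv z) = -reflectEquiv (perp z) := by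
  ext i; fin_cases i <;> simp [reflectEquiv_apply, reflect₂, perp]

/-- The Biot–Savart velocity of a reflected vorticity is minus the reflected velocity. -/
theorem biotSavart_comp_reflectEquiv (ω : EuclideanSpace ℝ (Fin 2) → ℝ)
    (x : EuclideanSpace ℝ (Fin 2)) :
    biotSavart (fun y => ω (reflectEquiv y)) x
      = -reflectEquiv (biotSavart ω (reflectEquiv x)) := by
  have hcomm : reflectEquiv (∫ y, (ω y / ‖reflectEquiv x - y‖ ^ 2) • perp (reflectEquiv x - y))
      = ∫ y, reflectEquiv ((ω y / ‖reflectEquiv x - y‖ ^ 2) • perp (reflectEquiv x - y)) :=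
    (reflectEquiv.toContinuousLinearEquiv.integral_comp_comm _).symm
  have hchange := reflectEquiv.measurePreserving.integral_comp
    reflectEquiv.toMeasurableEquiv.measurableEmbedding
    fun y => reflectEquiv ((ω y / ‖reflectEquiv x - y‖ ^ 2) • perp (reflectEquiv x - y))
  rw [biotSavart, biotSavart, map_smul, hcomm, ← hchange, ← smul_neg, ← integral_neg]
  congr 1
  refine integral_congr_ae (.of_forall fun y => ?_)
  simp only [← map_sub, LinearIsometryEquiv.norm_map, map_smul, perp_reflectEquiv, map_neg,
    reflectEquiv_reflectEquiv, smul_neg, neg_neg]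

theorem fderiv_comp_reflectEquiv (f : EuclideanSpace ℝ (Fin 2) → ℝ)
    (x v : EuclideanSpace ℝ (Fin 2)) :
    fderiv ℝ (fun y => f (reflectEquiv y)) x v
      = fderiv ℝ f (reflectEquiv x) (reflectEquiv v) :=
  congrArg (fun L => L v) (reflectEquiv.toContinuousLinearEquiv.comp_right_fderiv (f := f) (x := x))

/-- The mirror symmetry `σ₊(t,x₁,x₂) = σ₋(t,x₁,−x₂)` is
compatible with the unscreened right-handed system: if `(σ₊, σ₋)` is a smooth,
compactly supported, integrable solution, then the reflected pair
`η₊(t,x₁,x₂) = σ₋(t,x₁,−x₂)`, `η₋(t,x₁,x₂) = σ₊(t,x₁,−x₂)` is also a solution. -/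
theorem mirror_symmetry_preserved
    (σp σm : ℝ → EuclideanSpace ℝ (Fin 2) → ℝ)
    (hsp : ContDiff ℝ (⊤ : ℕ∞) fun p : ℝ × EuclideanSpace ℝ (Fin 2) => σp p.1 p.2)
    (hsm : ContDiff ℝ (⊤ : ℕ∞) fun p : ℝ × EuclideanSpace ℝ (Fin 2) => σm p.1 p.2)
    (hcp : ∀ t, HasCompactSupport (σp t)) (hcm : ∀ t, HasCompactSupport (σm t))
    (hip : ∀ t, Integrable (σp t) volume) (him : ∀ t, Integrable (σm t) volume)
    (hsol : SolvesUnscreenedRH σp σm)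
    (ηp ηm : ℝ → EuclideanSpace ℝ (Fin 2) → ℝ)
    (hηp : ηp = fun t x => σm t (reflect₂ x))
    (hηm : ηm = fun t x => σp t (reflect₂ x)) :
    SolvesUnscreenedRH ηp ηm := by
  subst hηp hηm
  intro t x
  obtain ⟨hp, hm⟩ := hsol t (reflectEquiv x)
  simp only [← reflectEquiv_apply, fderiv_comp_reflectEquiv, biotSavart_comp_reflectEquiv, map_neg,
    reflectEquiv_reflectEquiv, sub_neg_eq_add, ← sub_eq_add_neg]
  exact ⟨hm, hp⟩

end
end
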